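/- For every k ≥ 1, the odd cycle C_{2k+1} on 2k+1 vertices has pebbling number π(C_{2k+1}) = ⌈(2^{k+2} − 1)/3⌉, which equals 2·⌊2^{k+1}/3⌋ + 1. -/

import Mathlib

open Finset SimpleGraph

variable {V : Type*}

/-- A single pebbling move: remove two pebbles from `u` and add one pebble to a
neighbor `v`. -/
def PebblingMove (G : SimpleGraph V) (C C' : V → ℕ) : Prop :=
  ∃ u v : V, G.Adj u v ∧ 2 ≤ C u ∧
    C' u = C u - 2 ∧ C' v = C v + 1 ∧ ∀ x : V, x ≠ u → x ≠ v → C' x = C x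

/-- A configuration `C` is `r`-solvable if some finite sequence of pebbling moves
starting from `C` yields a configuration with at least one pebble on `r`. -/
def PebblingSolvable (G : SimpleGraph V) (r : V) (C : V → ℕ) : Prop :=
  ∃ C' : V → ℕ, Relation.ReflTransGen (PebblingMove G) C C' ∧ 1 ≤ C' r

/-- `piVertex G r` is the least `t` such that every configuration of size `t`
is `r`-solvable. -/
noncomputable def piVertex [Fintype V] (G : SimpleGraph V) (r : V) : ℕ :=
  sInf {t : ℕ | ∀ C : V → ℕ, (∑ v, C v) = t → PebblingSolvable G r C}

/-- The pebbling number `π(G) = max_r π(G,r)`. -/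
noncomputable def pebblingNumber [Fintype V] (G : SimpleGraph V) : ℕ :=
  Finset.univ.sup (fun r => piVertex G r)

/-- A (basic) strategy rooted at `r`: a subtree `T` of `G` containing `r` with
at least two vertices, together with a nonnegative, nonzero weight function `w`
vanishing off `T` and at `r`, with `w(v⁺) = 2·w(v)` for every vertex `v` of `T`
other than `r` and the children of `r`, where `v⁺` is the parent of `v`, i.e.
the neighbor of `v` on the path in `T` from `v` to `r`. -/
structure Strategy (G : SimpleGraph V) (r : V) where
  T : G.Subgraph
  w : V → ℚ
  root_mem : r ∈ T.verts
  two_le_ncard : 2 ≤ T.verts.ncard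
  isTree : T.coe.IsTree
  w_nonneg : ∀ v, 0 ≤ w v
  w_ne_zero : w ≠ 0
  w_outside : ∀ v, v ∉ T.verts → w v = 0
  w_root : w r = 0
  w_parent : ∀ u v : T.verts, T.coe.Adj u v → (v : V) ≠ r → ¬ T.Adj r (v : V) →
    T.coe.dist u ⟨r, root_mem⟩ < T.coe.dist v ⟨r, root_mem⟩ → w (u : V) = 2 * w (v : V)

/-- `w(C) = ∑_{v ∈ V(G)} w(v)·C(v)`. -/
noncomputable def configWeight [Fintype V] {G : SimpleGraph V} {r : V}
    (S : Strategy G r) (C : V → ℕ) : ℚ :=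
  ∑ v, S.w v * (C v : ℚ)

open Classical in
/-- `w(𝐓) = ∑_{v ∈ V(T), v ≠ r} w(v)`. -/
noncomputable def treeWeight [Fintype V] {G : SimpleGraph V} {r : V} (S : Strategy G r) : ℚ :=
  ∑ v ∈ Finset.univ.filter (fun v => v ∈ S.T.verts ∧ v ≠ r), S.w v

/-- Moving `q` pebbles from `u` to an adjacent vertex `v`, at the cost of `2 * q` pebbles. -/
lemma exists_reflTransGen_pebblingMove {G : SimpleGraph V} {u v : V} (h : G.Adj u v) (q : ℕ) :
    ∀ C : V → ℕ, 2 * q ≤ C u → ∃ C' : V → ℕ, Relation.ReflTransGen (PebblingMove G) C C' ∧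
      C' v = C v + q ∧ ∀ x, x ≠ u → x ≠ v → C' x = C x := by
  classical
  induction q with
  | zero => exact fun C _ => ⟨C, .refl, rfl, fun _ _ _ => rfl⟩
  | succ q ih =>
    intro C hC
    have hne : u ≠ v := h.ne
    obtain ⟨C', hreach, hv, hx⟩ :=
      ih (Function.update (Function.update C u (C u - 2)) v (C v + 1)) (by simp [hne]; omega)
    refine ⟨C', .head ⟨u, v, h, by omega, by simp [hne], by simp, ?_⟩ hreach, ?_, ?_⟩
    · intro x hxu hxv
      simp [hxu, hxv]
    · rw [hv]
      simp
      omega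
    · intro x hxu hxv
      rw [hx x hxu hxv]
      simp [hxu, hxv]

lemma PebblingSolvable.of_reflTransGen {G : SimpleGraph V} {r : V} {C C' : V → ℕ}
    (h : Relation.ReflTransGen (PebblingMove G) C C') (h' : PebblingSolvable G r C') :
    PebblingSolvable G r C :=
  let ⟨D, hD, hr⟩ := h'
  ⟨D, h.trans hD, hr⟩

/-- A configuration of weight at least `2 ^ L` along a path of length `L` starting at `p 0`, where
`p i` has weight `2 ^ (L - i)`, can reach `p 0`. -/
lemma pebblingSolvable_of_path {G : SimpleGraph V} (p : ℕ → V) (L : ℕ) :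
    (∀ i < L, G.Adj (p (i + 1)) (p i)) → Set.InjOn p (Set.Iic L) →
    ∀ C : V → ℕ, 2 ^ L ≤ ∑ i ∈ range (L + 1), 2 ^ (L - i) * C (p i) →
      PebblingSolvable G (p 0) C := by
  induction L with
  | zero =>
    intro _ _ C hC
    exact ⟨C, .refl, by simpa using hC⟩
  | succ L ih =>
    intro hadj hinj C hC
    have hne : ∀ i ≤ L + 1, ∀ j ≤ L + 1, i ≠ j → p i ≠ p j := fun i hi j hj hij h =>
      hij (hinj hi hj h)
    obtain ⟨C', hreach, hL, hx⟩ :=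
      exists_reflTransGen_pebblingMove (hadj L (by omega)) (C (p (L + 1)) / 2) C (by omega)
    refine .of_reflTransGen hreach (ih (fun i hi => hadj i (by omega))
      (hinj.mono (Set.Iic_subset_Iic.2 (by omega))) C' ?_)
    have h1 : ∑ i ∈ range (L + 1), 2 ^ (L + 1 - i) * C (p i)
        = 2 * ∑ i ∈ range (L + 1), 2 ^ (L - i) * C (p i) := by
      rw [mul_sum]
      refine sum_congr rfl fun i hi => ?_
      rw [mem_range] at hi
      rw [Nat.sub_add_comm (by omega), pow_succ]
      ring
    have h2 : ∑ i ∈ range L, 2 ^ (L - i) * C' (p i) = ∑ i ∈ range L, 2 ^ (L - i) * C (p i) := by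
      refine sum_congr rfl fun i hi => ?_
      rw [mem_range] at hi
      rw [hx _ (hne _ (by omega) _ (by omega) (by omega))
        (hne _ (by omega) _ (by omega) (by omega))]
    rw [sum_range_succ, h1, sum_range_succ, pow_succ] at hC
    rw [sum_range_succ, h2, hL]
    simp only [Nat.sub_self, pow_zero, one_mul] at hC ⊢
    omega

/-- A pebbling move from `u` to `v` does not increase the weight of a configuration if
`w v ≤ 2 * w u`. -/
lemma sum_mul_le_of_pebble_moved [Fintype V] {C C' : V → ℕ} {u v : V} (w : V → ℕ) (huv : u ≠ v)
    (h2 : 2 ≤ C u) (hu : C' u = C u - 2) (hv : C' v = C v + 1)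
    (hx : ∀ x, x ≠ u → x ≠ v → C' x = C x) (hw : w v ≤ 2 * w u) :
    ∑ x, w x * C' x ≤ ∑ x, w x * C x := by
  classical
  have key : ∑ x, w x * (C' x + if x = u then 2 else 0)
      = ∑ x, w x * (C x + if x = v then 1 else 0) := by
    refine sum_congr rfl fun x _ => ?_
    by_cases hxu : x = u
    · subst hxu
      simp [huv, hu, h2]
    · by_cases hxv : x = v
      · subst hxv
        simp [hxu, hv]
      · simp [hxu, hxv, hx]
  simp only [mul_add, sum_add_distrib, mul_ite, mul_zero, sum_ite_eq', mem_univ, if_true] at key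
  omega

section

open scoped Fin.CommRing

lemma cycleGraph_adj_natCast_succ {n : ℕ} [NeZero n] (hn : 1 < n) (r : Fin n) (i : ℕ) :
    (cycleGraph n).Adj (r + ((i + 1 : ℕ) : Fin n)) (r + (i : Fin n)) ∧
    (cycleGraph n).Adj (r - ((i + 1 : ℕ) : Fin n)) (r - (i : Fin n)) := by
  obtain ⟨n, rfl⟩ : ∃ m, n = m + 2 := ⟨n - 2, by omega⟩
  rw [cycleGraph_adj, cycleGraph_adj]
  push_cast
  exact ⟨.inl (by abel), .inr (by abel)⟩

lemma Fin.injOn_natCast {n : ℕ} [NeZero n] {L : ℕ} (hL : L < n) :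
    Set.InjOn (fun i : ℕ => (i : Fin n)) (Set.Iic L) := by
  intro i hi j hj hij
  simp only [Set.mem_Iic] at hi hj
  have := congrArg Fin.val hij
  simpa [Fin.val_natCast, Nat.mod_eq_of_lt (show i < n by omega),
    Nat.mod_eq_of_lt (show j < n by omega)] using this

/-- For a `C` unsolvable on the odd cycle, adding the weights of both paths of length `k + 1`
starting at the root bounds the size of `C`. -/
lemma pebblingSolvable_cycleGraph_odd {k : ℕ} (hk : 1 ≤ k) (r : Fin (2 * k + 1))
    (C : Fin (2 * k + 1) → ℕ) (hC : 2 ^ (k + 2) - 1 ≤ 3 * ∑ v, C v) :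
    PebblingSolvable (cycleGraph (2 * k + 1)) r C := by
  by_contra hns
  have hadj := cycleGraph_adj_natCast_succ (n := 2 * k + 1) (by omega) r
  have hinj := Fin.injOn_natCast (n := 2 * k + 1) (L := k + 1) (by omega)
  have ha := mt (pebblingSolvable_of_path (fun i : ℕ => r + (i : Fin (2 * k + 1))) (k + 1)
    (fun i _ => (hadj i).1) (fun i hi j hj h => hinj hi hj (add_left_cancel h)) C)
    (by simpa using hns)
  have hb := mt (pebblingSolvable_of_path (fun i : ℕ => r - (i : Fin (2 * k + 1))) (k + 1)
    (fun i _ => (hadj i).2) (fun i hi j hj h => hinj hi hj (sub_right_injective h)) C)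
    (by simpa using hns)
  have hab : ∀ i ≤ 2 * k + 1, C (r - (i : Fin (2 * k + 1)))
      = C (r + ((2 * k + 1 - i : ℕ) : Fin (2 * k + 1))) := by
    intro i hi
    congr 1
    rw [sub_eq_add_neg, add_right_inj, neg_eq_iff_add_eq_zero, ← Nat.cast_add,
      Nat.add_sub_cancel' hi, Fin.natCast_self]
  have hsum : ∑ v, C v = ∑ i ∈ range (2 * k + 1), C (r + (i : Fin (2 * k + 1))) := by
    rw [← Equiv.sum_comp (Equiv.addLeft r), ← Fin.sum_univ_eq_sum_range
      (fun i => C (r + (i : Fin (2 * k + 1))))]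
    simp
  rw [hsum] at hC
  simp only [not_le] at ha hb
  obtain ⟨a, haC⟩ : ∃ a : ℕ → ℕ, ∀ i, C (r + ((i : ℕ) : Fin (2 * k + 1))) = a i :=
    ⟨_, fun _ => rfl⟩
  obtain ⟨b, hbC⟩ : ∃ b : ℕ → ℕ, ∀ i, C (r - ((i : ℕ) : Fin (2 * k + 1))) = b i :=
    ⟨_, fun _ => rfl⟩
  simp only [haC, hbC] at ha hb hab hC
  obtain ⟨k, rfl⟩ : ∃ m, k = m + 1 := ⟨k - 1, by omega⟩
  have hsplit : ∑ i ∈ range (2 * (k + 1) + 1), a i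
      = a 0 + ∑ i ∈ range (k + 1), a (i + 1) + ∑ i ∈ range (k + 1), b (i + 1) := by
    rw [show 2 * (k + 1) + 1 = (k + 2) + (k + 1) by ring, sum_range_add, sum_range_succ',
      ← sum_range_reflect (fun i => b (i + 1))]
    have : ∀ i ∈ range (k + 1), a (k + 2 + i) = b (k + 1 - 1 - i + 1) := by
      intro i hi
      rw [mem_range] at hi
      rw [hab _ (by omega)]
      congr 1
      omega
    rw [sum_congr rfl this]
    ring
  have hpath : ∀ f : ℕ → ℕ, 3 * ∑ i ∈ range k, f (i + 1) + 2 * f (k + 1) + f (k + 2) + 3 * f 0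
      ≤ ∑ i ∈ range (k + 1 + 1 + 1), 2 ^ (k + 1 + 1 - i) * f i := by
    intro f
    rw [sum_range_succ, sum_range_succ, sum_range_succ', mul_sum]
    have h1 : ∑ i ∈ range k, 3 * f (i + 1)
        ≤ ∑ i ∈ range k, 2 ^ (k + 1 + 1 - (i + 1)) * f (i + 1) := by
      refine sum_le_sum fun i hi => Nat.mul_le_mul_right _ ?_
      rw [mem_range] at hi
      calc 3 ≤ 2 ^ 2 := by norm_num
        _ ≤ _ := Nat.pow_le_pow_right (by norm_num) (by omega)
    have h2 : 3 * f 0 ≤ 2 ^ (k + 1 + 1 - 0) * f 0 := by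
      refine Nat.mul_le_mul_right _ ?_
      calc 3 ≤ 2 ^ 2 := by norm_num
        _ ≤ _ := Nat.pow_le_pow_right (by norm_num) (by omega)
    have h3 : k + 1 + 1 - (k + 1) = 1 := by omega
    simp only [h3, Nat.sub_self, pow_zero, pow_one, one_mul]
    omega
  have hpa := hpath a
  have hpb := hpath b
  have e1 : b (k + 1) = a (k + 2) := by
    rw [hab _ (by omega)]
    congr 1
    omega
  have e2 : b (k + 2) = a (k + 1) := by
    rw [hab _ (by omega)]
    congr 1
    omega
  rw [hsplit, sum_range_succ, sum_range_succ] at hC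
  rw [show 2 ^ (k + 1 + 2) = 2 * 2 ^ (k + 1 + 1) from pow_succ' 2 (k + 1 + 1)] at hC
  generalize 2 ^ (k + 1 + 1) = N at ha hb hC
  omega

end

/-- Configurations with no pebble on `0` whose weights along both paths around the cycle are too
small are unsolvable. -/
lemma not_pebblingSolvable_cycleGraph_zero {n : ℕ} {C : Fin (n + 3) → ℕ} (h0 : C 0 = 0)
    (hdown : ∑ v, 2 ^ (n + 3 - v.val) * C v < 2 ^ (n + 3))
    (hup : ∑ v, 2 ^ v.val * C v < 2 ^ (n + 3)) :
    ¬ PebblingSolvable (cycleGraph (n + 3)) 0 C := by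
  rintro ⟨D, hD, hD0⟩
  suffices h : D 0 = 0 ∧ ∑ v, 2 ^ (n + 3 - v.val) * D v < 2 ^ (n + 3) ∧
      ∑ v, 2 ^ v.val * D v < 2 ^ (n + 3) by omega
  clear hD0
  induction hD with
  | refl => exact ⟨h0, hdown, hup⟩
  | @tail B B' _ hmove ih =>
    obtain ⟨hB0, hBd, hBu⟩ := ih
    obtain ⟨u, v, hadj, h2, hu, hv, hx⟩ := hmove
    have hu0 : u ≠ 0 := by
      rintro rfl
      omega
    have hu0' : u.val ≠ 0 := fun h => hu0 (Fin.ext h)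
    have hne := hadj.ne
    have hBd' : 2 ^ (n + 3 - u.val) * B u < 2 ^ (n + 3) :=
      (single_le_sum (f := fun v : Fin (n + 3) => 2 ^ (n + 3 - v.val) * B v)
        (fun _ _ => Nat.zero_le _) (mem_univ u)).trans_lt hBd
    have hBu' : 2 ^ u.val * B u < 2 ^ (n + 3) :=
      (single_le_sum (f := fun v : Fin (n + 3) => 2 ^ v.val * B v)
        (fun _ _ => Nat.zero_le _) (mem_univ u)).trans_lt hBu
    have hcases : u.val = v.val + 1 ∨ v.val = u.val + 1 ∨ (v.val = 0 ∧ u.val = n + 2) := by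
      rw [cycleGraph_adj', Fin.val_sub, Fin.val_sub] at hadj
      have := u.isLt
      have := v.isLt
      rcases lt_or_ge u.val v.val with h | h
      · rw [Nat.mod_eq_of_lt (by omega), Nat.mod_eq_sub_mod (by omega),
          Nat.mod_eq_of_lt (by omega)] at hadj
        omega
      · have huv : u.val ≠ v.val := fun h => hne (Fin.ext h)
        rw [Nat.mod_eq_sub_mod (by omega), Nat.mod_eq_of_lt (by omega),
          Nat.mod_eq_of_lt (by omega)] at hadj
        omega
    have hv0 : v.val ≠ 0 := by
      intro hv0
      rcases hcases with h | h | h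
      · rw [h, hv0, show n + 3 - (0 + 1) = n + 2 by omega, pow_succ 2 (n + 2)] at hBd'
        have := Nat.mul_le_mul_left (2 ^ (n + 2)) h2
        omega
      · omega
      · rw [h.2, pow_succ 2 (n + 2)] at hBu'
        have := Nat.mul_le_mul_left (2 ^ (n + 2)) h2
        omega
    have hv0' : v ≠ 0 := fun h => hv0 (by simp [h])
    refine ⟨by rw [hx 0 hu0.symm hv0'.symm, hB0], ?_, ?_⟩
    · refine (sum_mul_le_of_pebble_moved _ hne h2 hu hv hx ?_).trans_lt hBd
      rw [← pow_succ']
      exact Nat.pow_le_pow_right (by norm_num) (by omega)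
    · refine (sum_mul_le_of_pebble_moved _ hne h2 hu hv hx ?_).trans_lt hBu
      rw [← pow_succ']
      exact Nat.pow_le_pow_right (by norm_num) (by omega)

/-- The two vertices of the odd cycle farthest from `0` can hold `⌊2 ^ (k + 1) / 3⌋` pebbles each
without being able to reach `0`. -/
lemma exists_not_pebblingSolvable_cycleGraph_odd {k t : ℕ} (hk : 1 ≤ k)
    (ht : t ≤ 2 * (2 ^ (k + 1) / 3)) :
    ∃ C : Fin (2 * k + 1) → ℕ, ∑ v, C v = t ∧
      ¬ PebblingSolvable (cycleGraph (2 * k + 1)) 0 C := by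
  obtain ⟨a, b, rfl, ha, hb⟩ : ∃ a b, a + b = t ∧ a ≤ 2 ^ (k + 1) / 3 ∧ b ≤ 2 ^ (k + 1) / 3 :=
    ⟨t / 2, t - t / 2, by omega, by omega, by omega⟩
  obtain ⟨k, rfl⟩ : ∃ m, k = m + 1 := ⟨k - 1, by omega⟩
  let x : Fin (2 * k + 3) := ⟨k + 1, by omega⟩
  let y : Fin (2 * k + 3) := ⟨k + 2, by omega⟩
  have hsum : ∀ w : Fin (2 * k + 3) → ℕ,
      ∑ v, w v * (Pi.single x a + Pi.single y b : Fin (2 * k + 3) → ℕ) v = w x * a + w y * b := by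
    intro w
    simp [Pi.single_apply, mul_add, sum_add_distrib]
  have hmod : ¬ 3 ∣ 2 ^ (k + 1 + 1) := fun h => by
    have := Nat.prime_three.dvd_of_dvd_pow h
    omega
  have hpow : 2 ^ (2 * k + 3) = 2 ^ (k + 1) * 2 ^ (k + 1 + 1) := by
    rw [← pow_add]
    congr 1
    ring
  have hlt : 2 * a + b < 2 ^ (k + 1 + 1) ∧ a + 2 * b < 2 ^ (k + 1 + 1) := by omega
  have hpos : 0 < 2 ^ (k + 1) := by positivity
  have hsize := hsum 1
  simp only [Pi.one_apply, one_mul] at hsize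
  refine ⟨(Pi.single x a + Pi.single y b : Fin (2 * k + 3) → ℕ), hsize,
    not_pebblingSolvable_cycleGraph_zero (n := 2 * k) ?_ ?_ ?_⟩
  · simp [x, y, Fin.ext_iff]
  · rw [hsum, hpow]
    have e1 : 2 * k + 3 - x.val = k + 1 + 1 := by simp only [x]; omega
    have e2 : 2 * k + 3 - y.val = k + 1 := by simp only [y]; omega
    rw [e1, e2]
    calc 2 ^ (k + 1 + 1) * a + 2 ^ (k + 1) * b = 2 ^ (k + 1) * (2 * a + b) := by ring
      _ < _ := Nat.mul_lt_mul_of_pos_left hlt.1 hpos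
  · rw [hsum, hpow]
    calc 2 ^ (k + 1) * a + 2 ^ (k + 2) * b = 2 ^ (k + 1) * (a + 2 * b) := by ring
      _ < _ := Nat.mul_lt_mul_of_pos_left hlt.2 hpos

/-- The odd cycle `C_{2k+1}` (`k ≥ 1`) has pebbling number
`⌈(2^{k+2} − 1)/3⌉ = 2·⌊2^{k+1}/3⌋ + 1`. -/
theorem odd_cycle_pebbling_number (k : ℕ) (hk : 1 ≤ k) :
    pebblingNumber (SimpleGraph.cycleGraph (2 * k + 1)) = (2 ^ (k + 2) - 1 + 2) / 3 ∧
    (2 ^ (k + 2) - 1 + 2) / 3 = 2 * (2 ^ (k + 1) / 3) + 1 := by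
  have hmod : ¬ 3 ∣ 2 ^ (k + 1) := fun h => by
    have := Nat.prime_three.dvd_of_dvd_pow h
    omega
  have heq : (2 ^ (k + 2) - 1 + 2) / 3 = 2 * (2 ^ (k + 1) / 3) + 1 := by
    rw [show k + 2 = k + 1 + 1 from rfl, pow_succ 2 (k + 1)]
    omega
  have hmem : ∀ r, (2 ^ (k + 2) - 1 + 2) / 3 ∈ {t : ℕ | ∀ C : Fin (2 * k + 1) → ℕ,
      (∑ v, C v) = t → PebblingSolvable (cycleGraph (2 * k + 1)) r C} := by
    intro r C hC
    exact pebblingSolvable_cycleGraph_odd hk r C (by omega)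
  refine ⟨le_antisymm (Finset.sup_le fun r _ => Nat.sInf_le (hmem r)) ?_, heq⟩
  refine le_trans ?_ (Finset.le_sup (f := fun r => piVertex _ r) (mem_univ 0))
  refine le_csInf ⟨_, hmem 0⟩ fun t ht => ?_
  by_contra! hlt
  obtain ⟨C, hC, hns⟩ := exists_not_pebblingSolvable_cycleGraph_odd (t := t) hk (by omega)
  exact hns (ht C hC)
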